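/- arXiv:1608.08168 — 3 statements merged into one kernel-verified Lean document; each statement's English description precedes it below -/
import Mathlib

section
/- Let α, β > 0 and let K_a, K_b be positive integers. Let T_a and T_b be independent random variables where T_a has the Erlang distribution with shape K_a and rate α and T_b has the Erlang distribution with shape K_b and rate β. Then the probability that T_a < T_b (the probability that item a is chosen in the Poisson counter model) equals I_{α/(α+β)}(K_a, K_b). -/
open MeasureTheory ProbabilityTheory

/-- The regularized incomplete beta function
`I_q(a,b) = (∫₀¹ t^(a-1)(1-t)^(b-1) dt)⁻¹ · ∫₀^q t^(a-1)(1-t)^(b-1) dt`. -/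
noncomputable def regIncBeta (q a b : ℝ) : ℝ :=
  (∫ t in (0:ℝ)..1, t ^ (a - 1) * (1 - t) ^ (b - 1))⁻¹ *
    ∫ t in (0:ℝ)..q, t ^ (a - 1) * (1 - t) ^ (b - 1)

open Set in
lemma pc_gammaPDF_nat (m : ℕ) (r x : ℝ) (hx : 0 < x) :
    gammaPDF ((m + 1 : ℕ) : ℝ) r x =
      ENNReal.ofReal (r ^ (m + 1) / (m.factorial : ℝ) * x ^ m * Real.exp (-(r * x))) := by
  rw [gammaPDF_of_nonneg hx.le, Real.rpow_natCast]
  push_cast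
  rw [Real.Gamma_nat_eq_factorial, add_sub_cancel_right, Real.rpow_natCast]

open Set in
lemma pc_measurable (a r : ℝ) : Measurable (gammaPDF a r) :=
  (measurable_gammaPDFReal a r).ennreal_ofReal

open Set in
lemma pc_gamma_int (n : ℕ) (c : ℝ) (hc : 0 < c) :
    ∫⁻ y in Ioi (0:ℝ), ENNReal.ofReal (y ^ n * Real.exp (-(c * y))) =
      ENNReal.ofReal ((n.factorial : ℝ) / c ^ (n + 1)) := by
  have h1 := lintegral_gammaPDF_eq_one (a := ((n + 1 : ℕ) : ℝ)) (r := c) (by positivity) hc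
  rw [← lintegral_add_compl _ (measurableSet_Ioi (a := (0:ℝ)))] at h1
  have h0 : ∫⁻ x in (Ioi (0:ℝ))ᶜ, gammaPDF ((n + 1 : ℕ) : ℝ) c x = 0 := by
    rw [compl_Ioi, setLIntegral_congr Iio_ae_eq_Iic.symm]
    exact lintegral_gammaPDF_of_nonpos le_rfl
  rw [h0, add_zero] at h1
  have h2 : ∀ x ∈ Ioi (0:ℝ), ENNReal.ofReal (x ^ n * Real.exp (-(c * x))) =
      ENNReal.ofReal ((n.factorial : ℝ) / c ^ (n + 1)) * gammaPDF ((n + 1 : ℕ) : ℝ) c x := by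
    intro x hx
    rw [pc_gammaPDF_nat n c x hx, ← ENNReal.ofReal_mul (by positivity)]
    congr 1
    have : (n.factorial : ℝ) ≠ 0 := by positivity
    field_simp
  rw [setLIntegral_congr_fun measurableSet_Ioi h2, lintegral_const_mul _ (pc_measurable _ _), h1,
    mul_one]

open Set in
lemma pc_scale (F : ℝ → ENNReal) (y : ℝ) (hy : 0 < y) :
    ∫⁻ x in Ioo 0 y, F x = ∫⁻ s in Ioo (0:ℝ) 1, ENNReal.ofReal y * F (y * s) := by
  have h := lintegral_image_eq_lintegral_abs_deriv_mul (s := Ioo (0:ℝ) 1)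
    (f := fun s => y * s) (f' := fun _ => y) measurableSet_Ioo
    (fun x _ => by simpa using ((hasDerivAt_id x).const_mul y).hasDerivWithinAt)
    (fun a _ b _ hab => mul_left_cancel₀ hy.ne' hab) F
  have himg : (fun s => y * s) '' Ioo (0:ℝ) 1 = Ioo 0 y := by
    rw [image_mul_left_Ioo hy]; simp
  rw [himg, abs_of_pos hy] at h
  exact h

open Set in
lemma pc_subst (m k : ℕ) (α β : ℝ) (hα : 0 < α) (hβ : 0 < β) :
    ∫ s in (0:ℝ)..1, α ^ (m + 1) * β ^ (k + 1) * s ^ m / (α * s + β) ^ (m + k + 2) =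
      ∫ t in (0:ℝ)..(α / (α + β)), t ^ m * (1 - t) ^ k := by
  have hpos : ∀ s ∈ uIcc (0:ℝ) 1, 0 < α * s + β := by
    intro s hs
    rw [uIcc_of_le zero_le_one] at hs
    have := mul_nonneg hα.le hs.1
    linarith
  have h := intervalIntegral.integral_comp_mul_deriv (a := 0) (b := 1)
    (f := fun s : ℝ => α * s / (α * s + β)) (f' := fun s => α * β / (α * s + β) ^ 2)
    (g := fun t : ℝ => t ^ m * (1 - t) ^ k)
    (fun s hs => by
      have hp := (hpos s hs).ne'
      have h1 : HasDerivAt (fun s : ℝ => α * s) α s := by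
        simpa using (hasDerivAt_id s).const_mul α
      have h2 := h1.div (h1.add_const β) hp
      have e : (α * (α * s + β) - α * s * α) / (α * s + β) ^ 2 = α * β / (α * s + β) ^ 2 := by
        ring
      rw [e] at h2
      exact h2)
    (ContinuousOn.div (by fun_prop) (by fun_prop) (fun s hs => pow_ne_zero _ (hpos s hs).ne'))
    (by fun_prop)
  simp only [mul_zero, zero_div, mul_one] at h
  rw [← h]
  apply intervalIntegral.integral_congr
  intro s hs
  have hp := (hpos s hs).ne'
  have h1 : 1 - α * s / (α * s + β) = β / (α * s + β) := by field_simp; ring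
  simp only [Function.comp]
  rw [h1, div_pow, div_pow]
  field_simp
  ring

open Set in
lemma pc_beta (m k : ℕ) :
    ∫ t in (0:ℝ)..1, t ^ m * (1 - t) ^ k =
      (m.factorial : ℝ) * k.factorial / (m + k + 1).factorial := by
  have h := beta_eq_betaIntegralReal ((m + 1 : ℕ) : ℝ) ((k + 1 : ℕ) : ℝ)
    (by positivity) (by positivity)
  have h2 : Complex.betaIntegral (((m + 1 : ℕ) : ℝ) : ℂ) (((k + 1 : ℕ) : ℝ) : ℂ) =
      ((∫ t in (0:ℝ)..1, t ^ m * (1 - t) ^ k : ℝ) : ℂ) := by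
    rw [Complex.betaIntegral, ← intervalIntegral.integral_ofReal]
    apply intervalIntegral.integral_congr
    intro t _
    simp
  rw [h2, Complex.ofReal_re] at h
  rw [← h, beta]
  have e : ((m + 1 : ℕ) : ℝ) + ((k + 1 : ℕ) : ℝ) = ((m + k + 1 : ℕ) : ℝ) + 1 := by
    push_cast; ring
  rw [e, Real.Gamma_nat_eq_factorial]
  push_cast
  rw [Real.Gamma_nat_eq_factorial, Real.Gamma_nat_eq_factorial]

open Set in
lemma pc_inner (m k : ℕ) (α β : ℝ) (hα : 0 < α) (hβ : 0 < β) (s : ℝ) (hs : 0 < s) :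
    ∫⁻ y in Ioi (0:ℝ), gammaPDF ((k + 1 : ℕ) : ℝ) β y *
        (ENNReal.ofReal y * gammaPDF ((m + 1 : ℕ) : ℝ) α (y * s)) =
      ENNReal.ofReal (((m + k + 1).factorial : ℝ) / (m.factorial * k.factorial) *
        (α ^ (m + 1) * β ^ (k + 1) * s ^ m / (α * s + β) ^ (m + k + 2))) := by
  have h : ∀ y ∈ Ioi (0:ℝ), gammaPDF ((k + 1 : ℕ) : ℝ) β y *
        (ENNReal.ofReal y * gammaPDF ((m + 1 : ℕ) : ℝ) α (y * s)) =
      ENNReal.ofReal (α ^ (m + 1) * β ^ (k + 1) * s ^ m / (m.factorial * k.factorial)) *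
        ENNReal.ofReal (y ^ (m + k + 1) * Real.exp (-((α * s + β) * y))) := by
    intro y hy
    have hy : 0 < y := hy
    rw [pc_gammaPDF_nat _ _ _ hy, pc_gammaPDF_nat _ _ _ (mul_pos hy hs),
      ← ENNReal.ofReal_mul hy.le, ← ENNReal.ofReal_mul (by positivity),
      ← ENNReal.ofReal_mul (by positivity)]
    congr 1
    have : -((α * s + β) * y) = -(β * y) + -(α * (y * s)) := by ring
    rw [this, Real.exp_add]
    field_simp
    ring
  rw [setLIntegral_congr_fun measurableSet_Ioi h, lintegral_const_mul _ (by fun_prop),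
    pc_gamma_int _ _ (by positivity), ← ENNReal.ofReal_mul (by positivity)]
  congr 1
  field_simp

open Set in
lemma pc_gammaMeasure_Iio (m : ℕ) (α y : ℝ) (hy : 0 < y) :
    gammaMeasure ((m + 1 : ℕ) : ℝ) α (Iio y) =
      ∫⁻ s in Ioo (0:ℝ) 1, ENNReal.ofReal y * gammaPDF ((m + 1 : ℕ) : ℝ) α (y * s) := by
  rw [← pc_scale _ y hy, gammaMeasure, withDensity_apply _ measurableSet_Iio,
    ← Iio_union_Ico_eq_Iio hy.le, lintegral_union measurableSet_Ico,
    lintegral_gammaPDF_of_nonpos le_rfl, zero_add, setLIntegral_congr Ioo_ae_eq_Ico.symm]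
  rw [Set.disjoint_left]
  intro x hx hx'
  exact absurd hx'.1 (not_le.mpr hx)

open Set in
lemma pc_prod (m k : ℕ) (α β : ℝ) (hα : 0 < α) (hβ : 0 < β) :
    ((gammaMeasure ((m + 1 : ℕ) : ℝ) α).prod (gammaMeasure ((k + 1 : ℕ) : ℝ) β)
      {p : ℝ × ℝ | p.1 < p.2}) =
    ∫⁻ s in Ioo (0:ℝ) 1, ENNReal.ofReal (((m + k + 1).factorial : ℝ) / (m.factorial * k.factorial) *
        (α ^ (m + 1) * β ^ (k + 1) * s ^ m / (α * s + β) ^ (m + k + 2))) := by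
  have iA : IsProbabilityMeasure (gammaMeasure ((m + 1 : ℕ) : ℝ) α) :=
    isProbabilityMeasure_gammaMeasure (by positivity) hα
  have iB : IsProbabilityMeasure (gammaMeasure ((k + 1 : ℕ) : ℝ) β) :=
    isProbabilityMeasure_gammaMeasure (by positivity) hβ
  have hS : MeasurableSet {p : ℝ × ℝ | p.1 < p.2} := measurableSet_lt measurable_fst measurable_snd
  have mA := pc_measurable ((m + 1 : ℕ) : ℝ) α
  have mB := pc_measurable ((k + 1 : ℕ) : ℝ) β
  rw [Measure.prod_apply_symm hS]
  have hpre : ∀ y : ℝ, (fun x => (x, y)) ⁻¹' {p : ℝ × ℝ | p.1 < p.2} = Iio y := fun y => rfl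
  simp_rw [hpre]
  have hmeas : Measurable fun y => gammaMeasure ((m + 1 : ℕ) : ℝ) α (Iio y) :=
    measurable_measure_prodMk_right hS
  have hB : gammaMeasure ((k + 1 : ℕ) : ℝ) β =
      volume.withDensity (gammaPDF ((k + 1 : ℕ) : ℝ) β) := rfl
  rw [hB, lintegral_withDensity_eq_lintegral_mul _ mB hmeas,
    ← lintegral_add_compl _ (measurableSet_Ioi (a := (0:ℝ)))]
  have h0 : ∫⁻ y in (Ioi (0:ℝ))ᶜ, (gammaPDF ((k + 1 : ℕ) : ℝ) β *
      fun y => gammaMeasure ((m + 1 : ℕ) : ℝ) α (Iio y)) y = 0 := by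
    rw [compl_Ioi, setLIntegral_congr Iio_ae_eq_Iic.symm]
    refine setLIntegral_eq_zero measurableSet_Iio fun y hy => ?_
    simp [gammaPDF_of_neg hy]
  rw [h0, add_zero]
  have h1 : ∀ y ∈ Ioi (0:ℝ), (gammaPDF ((k + 1 : ℕ) : ℝ) β *
      fun y => gammaMeasure ((m + 1 : ℕ) : ℝ) α (Iio y)) y =
      ∫⁻ s in Ioo (0:ℝ) 1, gammaPDF ((k + 1 : ℕ) : ℝ) β y *
        (ENNReal.ofReal y * gammaPDF ((m + 1 : ℕ) : ℝ) α (y * s)) := by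
    intro y hy
    rw [Pi.mul_apply, pc_gammaMeasure_Iio m α y hy, ← lintegral_const_mul _ (by fun_prop)]
  rw [setLIntegral_congr_fun measurableSet_Ioi h1, lintegral_lintegral_swap]
  · exact setLIntegral_congr_fun measurableSet_Ioo fun s hs => pc_inner m k α β hα hβ s hs.1
  · apply Measurable.aemeasurable
    unfold Function.uncurry
    fun_prop

/-- In the Poisson counter model, with independent Erlang arrival times `T_a` (shape `K_a`,
rate `α`) and `T_b` (shape `K_b`, rate `β`), the probability that item `a` is chosen is
`P(T_a < T_b) = I_{α/(α+β)}(K_a, K_b)`. -/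
theorem poisson_counter_choice_probability {Ω : Type*} [MeasurableSpace Ω]
    (μ : Measure Ω) [IsProbabilityMeasure μ] (Ta Tb : Ω → ℝ)
    (hTa : Measurable Ta) (hTb : Measurable Tb)
    (Ka Kb : ℕ) (hKa : 1 ≤ Ka) (hKb : 1 ≤ Kb) (α β : ℝ) (hα : 0 < α) (hβ : 0 < β)
    (hindep : IndepFun Ta Tb μ)
    (hlawA : μ.map Ta = gammaMeasure Ka α)
    (hlawB : μ.map Tb = gammaMeasure Kb β) :
    (μ {ω | Ta ω < Tb ω}).toReal = regIncBeta (α / (α + β)) (Ka : ℝ) (Kb : ℝ) := by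
  obtain ⟨m, rfl⟩ := Nat.exists_eq_add_of_le' hKa
  obtain ⟨k, rfl⟩ := Nat.exists_eq_add_of_le' hKb
  have hS : MeasurableSet {p : ℝ × ℝ | p.1 < p.2} := measurableSet_lt measurable_fst measurable_snd
  have hμ : μ {ω | Ta ω < Tb ω} = (μ.map (fun ω => (Ta ω, Tb ω))) {p : ℝ × ℝ | p.1 < p.2} := by
    rw [Measure.map_apply (hTa.prodMk hTb) hS]
    rfl
  rw [hμ, (indepFun_iff_map_prod_eq_prod_map_map hTa.aemeasurable hTb.aemeasurable).mp hindep,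
    hlawA, hlawB, pc_prod m k α β hα hβ, ← integral_eq_lintegral_of_nonneg_ae]
  · rw [integral_const_mul, ← integral_Ioc_eq_integral_Ioo,
      ← intervalIntegral.integral_of_le zero_le_one, pc_subst m k α β hα hβ, regIncBeta]
    have e : ∀ n : ℕ, ((n + 1 : ℕ) : ℝ) - 1 = (n : ℝ) := fun n => by push_cast; ring
    simp_rw [e, Real.rpow_natCast]
    rw [pc_beta, inv_div]
  · refine ae_restrict_of_forall_mem measurableSet_Ioo fun s hs => ?_
    have := hs.1
    simp only [Pi.zero_apply]
    positivity
  · exact Measurable.aestronglyMeasurable (by fun_prop)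
end

section
/- Let σ > 0, d ≠ 0, z > 0, and K = 2z, and let p = (1 − e^{−2dz/σ²})/(1 − e^{−2dK/σ²}). Then the conditional mean response times of the drift diffusion model with symmetric starting point are equal, i.e., (1/p) · e^{d(K−z)/σ²} · Σ_{n=1}^{∞} n · sin(π(K−z)n/K) / (n² + (dK/(πσ²))²)² = (1/(1−p)) · e^{−dz/σ²} · Σ_{n=1}^{∞} n · sin(πzn/K) / (n² + (dK/(πσ²))²)². -/
open Real

/-- In the drift diffusion model with symmetric starting point (`K = 2z`), the conditional
mean response times given choosing item `a` or item `b` are equal: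
`(1/p) e^(d(K−z)/σ²) Σ_{n≥1} n sin(π(K−z)n/K)/(n² + (dK/(πσ²))²)²
  = (1/(1−p)) e^(−dz/σ²) Σ_{n≥1} n sin(πzn/K)/(n² + (dK/(πσ²))²)²`,
where `p = (1 − e^(−2dz/σ²))/(1 − e^(−2dK/σ²))`. -/
theorem ddm_symmetric_conditional_means_equal (σ d z K p : ℝ)
    (hσ : 0 < σ) (hd : d ≠ 0) (hz : 0 < z) (hK : K = 2 * z)
    (hp : p = (1 - Real.exp (-2 * d * z / σ ^ 2)) / (1 - Real.exp (-2 * d * K / σ ^ 2))) :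
    (1 / p) * Real.exp (d * (K - z) / σ ^ 2) *
        ∑' n : ℕ, ((n : ℝ) + 1) * Real.sin (π * (K - z) * ((n : ℝ) + 1) / K) /
          ((((n : ℝ) + 1) ^ 2 + (d * K / (π * σ ^ 2)) ^ 2) ^ 2) =
      (1 / (1 - p)) * Real.exp (-(d * z) / σ ^ 2) *
        ∑' n : ℕ, ((n : ℝ) + 1) * Real.sin (π * z * ((n : ℝ) + 1) / K) /
          ((((n : ℝ) + 1) ^ 2 + (d * K / (π * σ ^ 2)) ^ 2) ^ 2) := by
  have hKz : K - z = z := by rw [hK]; ring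
  rw [hKz]
  congr 1
  have hs : σ ^ 2 ≠ 0 := by positivity
  set E := Real.exp (-(d * z) / σ ^ 2) with hE
  have hE0 : 0 < E := Real.exp_pos _
  have h1 : Real.exp (d * z / σ ^ 2) = E⁻¹ := by
    rw [hE, ← Real.exp_neg]; congr 1; ring
  have h2 : Real.exp (-2 * d * z / σ ^ 2) = E ^ 2 := by
    rw [hE, ← Real.exp_nat_mul]; congr 1; push_cast; ring
  have h3 : Real.exp (-2 * d * K / σ ^ 2) = E ^ 4 := by
    rw [hE, ← Real.exp_nat_mul, hK]; congr 1; push_cast; ring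
  have hne : 1 - E ^ 2 ≠ 0 := by
    rw [← h2]
    intro h
    have h4 : Real.exp (-2 * d * z / σ ^ 2) = 1 := by linarith
    rw [Real.exp_eq_one_iff] at h4
    have : -2 * d * z / σ ^ 2 ≠ 0 :=
      div_ne_zero (mul_ne_zero (mul_ne_zero (by norm_num) hd) hz.ne') hs
    exact this h4
  have hpos : 1 + E ^ 2 ≠ 0 := by positivity
  have hp' : p = 1 / (1 + E ^ 2) := by
    rw [hp, h2, h3, show 1 - E ^ 4 = (1 - E ^ 2) * (1 + E ^ 2) by ring]
    field_simp
  have hq : 1 - p = E ^ 2 / (1 + E ^ 2) := by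
    rw [hp']; field_simp; ring
  rw [h1, hq, hp']
  field_simp
end

section
/- Let σ > 0, d ≠ 0, K > 0, and z ∈ (0, K). Let u(t) = (2π/K²) e^{−dz/σ²} Σ_{n=1}^{∞} n · e^{−(σ²π²n²/K² + d²/σ²)t} · sin(πzn/K) be the density of the first hitting time of 0 before K for a Brownian motion with drift d, variance σ², and initial value z. Then the first moment of this density satisfies ∫₀^∞ t · u(t) dt = (2K² e^{−dz/σ²}/(π³ σ⁴)) · Σ_{n=1}^{∞} n · sin(πzn/K) / (n² + (dK/(πσ²))²)². -/
open Real MeasureTheory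

lemma ddm_aux_int (r : ℝ) (hr : 0 < r) :
    ∫ t in Set.Ioi (0:ℝ), t * Real.exp (-r * t) = 1 / r ^ 2 := by
  have h := Real.integral_rpow_mul_exp_neg_mul_Ioi (a := 2) (r := r) (by norm_num) hr
  rw [Real.Gamma_two, mul_one] at h
  have e : (2:ℝ) - 1 = 1 := by norm_num
  simp only [e, Real.rpow_one, Real.rpow_two, one_div, inv_pow] at h
  rw [one_div, ← h]
  congr 1
  funext t
  rw [neg_mul]

lemma ddm_aux_integrable (r : ℝ) (hr : 0 < r) :
    IntegrableOn (fun t : ℝ => t * Real.exp (-r * t)) (Set.Ioi (0:ℝ)) := by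
  by_contra hn
  have h := ddm_aux_int r hr
  rw [integral_undef hn] at h
  have : 0 < 1 / r ^ 2 := by positivity
  linarith

/-- First moment of Feller's series density for the first hitting time of `0` before `K`
of a Brownian motion with drift `d`, variance `σ²`, and initial value `z ∈ (0, K)`:
`∫₀^∞ t u(t) dt = (2K² e^(−dz/σ²)/(π³σ⁴)) Σ_{n≥1} n sin(πzn/K)/(n² + (dK/(πσ²))²)²`,
where `u(t) = (2π/K²) e^(−dz/σ²) Σ_{n≥1} n e^(−(σ²π²n²/K² + d²/σ²)t) sin(πzn/K)`. -/
theorem ddm_hitting_time_first_moment (σ d K z : ℝ)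
    (hσ : 0 < σ) (hd : d ≠ 0) (hK : 0 < K) (hz : z ∈ Set.Ioo (0:ℝ) K) :
    ∫ t in Set.Ioi (0:ℝ),
        t * ((2 * π / K ^ 2) * Real.exp (-(d * z) / σ ^ 2) *
          ∑' n : ℕ, ((n : ℝ) + 1) *
            Real.exp (-(σ ^ 2 * π ^ 2 * ((n : ℝ) + 1) ^ 2 / K ^ 2 + d ^ 2 / σ ^ 2) * t) *
            Real.sin (π * z * ((n : ℝ) + 1) / K)) =
      (2 * K ^ 2 * Real.exp (-(d * z) / σ ^ 2) / (π ^ 3 * σ ^ 4)) *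
        ∑' n : ℕ, ((n : ℝ) + 1) * Real.sin (π * z * ((n : ℝ) + 1) / K) /
          ((((n : ℝ) + 1) ^ 2 + (d * K / (π * σ ^ 2)) ^ 2) ^ 2) := by
  have hpi := Real.pi_pos
  set r : ℕ → ℝ := fun n => σ ^ 2 * π ^ 2 * ((n : ℝ) + 1) ^ 2 / K ^ 2 + d ^ 2 / σ ^ 2 with hrdef
  set s : ℕ → ℝ := fun n => Real.sin (π * z * ((n : ℝ) + 1) / K) with hsdef
  set C : ℝ := (2 * π / K ^ 2) * Real.exp (-(d * z) / σ ^ 2) with hC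
  have hr : ∀ n, 0 < r n := fun n => by simp only [hrdef]; positivity
  set F : ℕ → ℝ → ℝ := fun n t => (C * ((n : ℝ) + 1) * s n) * (t * Real.exp (-r n * t)) with hF
  have hFi : ∀ n, Integrable (F n) (volume.restrict (Set.Ioi (0:ℝ))) := fun n =>
    (ddm_aux_integrable (r n) (hr n)).const_mul _
  have hnorm : ∀ n, ∫ t in Set.Ioi (0:ℝ), ‖F n t‖ = |C * ((n : ℝ) + 1) * s n| * (1 / r n ^ 2) := by
    intro n
    rw [← ddm_aux_int (r n) (hr n), ← integral_const_mul]
    refine setIntegral_congr_fun measurableSet_Ioi (fun t ht => ?_)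
    have ht' : 0 < t := ht
    simp only [hF, norm_mul, Real.norm_eq_abs, abs_mul, Real.abs_exp, abs_of_pos ht']
  have hsum : Summable fun n => ∫ t in Set.Ioi (0:ℝ), ‖F n t‖ := by
    simp only [hnorm]
    have hb : Summable fun n : ℕ => (|C| * (K ^ 2 / (σ ^ 2 * π ^ 2)) ^ 2) *
        (1 / (((n + 1 : ℕ) : ℝ)) ^ 3) :=
      (((summable_nat_add_iff 1).2 (Real.summable_one_div_nat_pow.2
        (by norm_num : 1 < 3)))).mul_left _
    refine Summable.of_nonneg_of_le (fun n => by positivity) (fun n => ?_) hb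
    have hn : (0:ℝ) < (n : ℝ) + 1 := by positivity
    have hs : |s n| ≤ 1 := Real.abs_sin_le_one _
    have hle : σ ^ 2 * π ^ 2 * ((n : ℝ) + 1) ^ 2 / K ^ 2 ≤ r n := by
      simp only [hrdef]
      have : 0 ≤ d ^ 2 / σ ^ 2 := by positivity
      linarith
    have h1 : 1 / r n ^ 2 ≤ 1 / (σ ^ 2 * π ^ 2 * ((n : ℝ) + 1) ^ 2 / K ^ 2) ^ 2 := by
      gcongr
    rw [abs_mul, abs_mul, abs_of_pos hn]
    calc |C| * ((n : ℝ) + 1) * |s n| * (1 / r n ^ 2)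
        ≤ |C| * ((n : ℝ) + 1) * 1 *
          (1 / (σ ^ 2 * π ^ 2 * ((n : ℝ) + 1) ^ 2 / K ^ 2) ^ 2) := by gcongr
      _ = _ := by push_cast; field_simp
  have hmain := integral_tsum_of_summable_integral_norm hFi hsum
  have hL : ∀ t : ℝ, t * (C * ∑' n : ℕ, ((n : ℝ) + 1) * Real.exp (-r n * t) * s n)
      = ∑' n, F n t := by
    intro t
    rw [← tsum_mul_left, ← tsum_mul_left]
    refine tsum_congr fun n => ?_
    simp only [hF]; ring
  have hR : ∀ n : ℕ, ∫ t in Set.Ioi (0:ℝ), F n t =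
      (2 * K ^ 2 * Real.exp (-(d * z) / σ ^ 2) / (π ^ 3 * σ ^ 4)) *
      (((n : ℝ) + 1) * s n / ((((n : ℝ) + 1) ^ 2 + (d * K / (π * σ ^ 2)) ^ 2) ^ 2)) := by
    intro n
    simp only [hF]
    rw [integral_const_mul, ddm_aux_int (r n) (hr n)]
    have e : r n = (σ ^ 2 * π ^ 2 / K ^ 2) *
        (((n : ℝ) + 1) ^ 2 + (d * K / (π * σ ^ 2)) ^ 2) := by
      simp only [hrdef]; field_simp
    have hq : 0 < ((n : ℝ) + 1) ^ 2 + (d * K / (π * σ ^ 2)) ^ 2 := by positivity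
    rw [e, hC]
    generalize ((n : ℝ) + 1) ^ 2 + (d * K / (π * σ ^ 2)) ^ 2 = q at hq
    generalize Real.exp (-(d * z) / σ ^ 2) = E
    field_simp
  rw [← tsum_mul_left]
  calc _ = ∫ t in Set.Ioi (0:ℝ), ∑' n, F n t := by
        congr 1; funext t; exact hL t
    _ = ∑' n, ∫ t in Set.Ioi (0:ℝ), F n t := hmain.symm
    _ = _ := tsum_congr hR
end
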